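/- Let k = 1. Let E ⊆ (0, a] be a measurable set with sup E ≤ a − Δ for some Δ > 0, let I = (a,b) with 0 < a < b, and let I' = (a−Δ, b−Δ') with 0 ≤ Δ' and a−Δ < b−Δ', where Δ' is chosen so that μ(I') = μ(I). Then ‖T 1_{E ∪ I'}‖_{L^q(ν)} ≥ ‖T 1_{E ∪ I}‖_{L^q(ν)}; that is, sliding the far interval of the set toward the origin (preserving its μ-measure) does not decrease the L^q(ν)-norm of the image under T. -/

import Mathlib

open MeasureTheory Set Filter Topology

noncomputable section

/-- The measure `r^(d-1) dr` on `(0, ∞)`. -/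
def mu (d : ℕ) : Measure ℝ :=
  (volume.restrict (Ioi (0:ℝ))).withDensity (fun r => ENNReal.ofReal (r ^ (d - 1)))

/-- The measure `r^(d-k-1) dr` on `(0, ∞)`. -/
def nu (d k : ℕ) : Measure ℝ :=
  (volume.restrict (Ioi (0:ℝ))).withDensity (fun r => ENNReal.ofReal (r ^ (d - k - 1)))

/-- The one-dimensional model operator for the k-plane transform on radial functions. -/
def T (k : ℕ) (f : ℝ → ℝ) (r : ℝ) : ℝ :=
  ∫ u in Ioi r, f u * (u ^ 2 - r ^ 2) ^ ((k : ℝ) / 2 - 1) * u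

/-- `p = (d+1)/(k+1)`. -/
def pExp (d k : ℕ) : ℝ := ((d : ℝ) + 1) / ((k : ℝ) + 1)

/-- `q = d+1`. -/
def qExp (d : ℕ) : ℝ := (d : ℝ) + 1

/-- `B` is the best constant in the `L^p(μ) → L^q(ν)` inequality for `T`. -/
def IsBestConstant (d k : ℕ) (B : ℝ) : Prop :=
  IsLeast {C : ℝ | 0 ≤ C ∧ ∀ f : ℝ → ℝ, Measurable f → (∀ r, 0 ≤ f r) →
    eLpNorm (T k f) (ENNReal.ofReal (qExp d)) (nu d k) ≤
      ENNReal.ofReal C * eLpNorm f (ENNReal.ofReal (pExp d k)) (mu d)} B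

/-- `(f n)` is an extremizing sequence for the inequality. -/
def Extremizing (d k : ℕ) (B : ℝ) (f : ℕ → ℝ → ℝ) : Prop :=
  (∀ n, Measurable (f n)) ∧ (∀ n r, 0 ≤ f n r) ∧
  (∀ n, eLpNorm (f n) (ENNReal.ofReal (pExp d k)) (mu d) = 1) ∧
  Tendsto (fun n => (eLpNorm (T k (f n)) (ENNReal.ofReal (qExp d)) (nu d k)).toReal)
    atTop (𝓝 B)

theorem integrableOn_and_lintegral_of_hasDerivAt_nonneg {F f : ℝ → ℝ} {a b : ℝ} (hab : a ≤ b)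
    (hc : ContinuousOn F (Icc a b)) (hF : ∀ x ∈ Ioo a b, HasDerivAt F (f x) x)
    (hf : ∀ x ∈ Ioo a b, 0 ≤ f x) :
    IntegrableOn f (Ioo a b) ∧ (∫ x in Ioo a b, f x = F b - F a) ∧
      ∫⁻ x in Ioo a b, ENNReal.ofReal (f x) = ENNReal.ofReal (F b - F a) := by
  have hi : IntegrableOn f (Ioc a b) := intervalIntegral.integrableOn_deriv_of_nonneg hc hF hf
  have hi' : IntegrableOn f (Ioo a b) := hi.mono_set Ioo_subset_Ioc_self
  have h := intervalIntegral.integral_eq_sub_of_hasDerivAt_of_le hab hc hF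
    ((intervalIntegrable_iff_integrableOn_Ioc_of_le hab).2 hi)
  rw [intervalIntegral.integral_of_le hab, integral_Ioc_eq_integral_Ioo] at h
  refine ⟨hi', h, ?_⟩
  rw [← h, ofReal_integral_eq_lintegral_ofReal hi']
  exact (ae_restrict_iff' measurableSet_Ioo).2 (.of_forall hf)

theorem hasDerivAt_sqrt_sq_sub_sq {r x : ℝ} (hr : 0 ≤ r) (hx : r < x) :
    HasDerivAt (fun x => √(x ^ 2 - r ^ 2)) (x / √(x ^ 2 - r ^ 2)) x := by
  have h : x ^ 2 - r ^ 2 ≠ 0 := by nlinarith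
  have := (((hasDerivAt_id x).pow 2).sub_const (r ^ 2)).sqrt h
  refine this.congr_deriv ?_
  simp
  ring

theorem sqrt_max_sq_sub_sq {a r : ℝ} (ha : 0 ≤ a) :
    √(max a r ^ 2 - r ^ 2) = √(a ^ 2 - r ^ 2) := by
  rcases le_total a r with h | h
  · rw [max_eq_right h, Real.sqrt_eq_zero_of_nonpos (by linarith),
      Real.sqrt_eq_zero_of_nonpos (by nlinarith)]
  · rw [max_eq_left h]

/-- The density of `(√(b² - r²) - √(a² - r²)) ^ (d + 1)` over pairs of points of the chord. -/
def chordKernel (d : ℕ) (x y r : ℝ) : ℝ :=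
  (√(y ^ 2 - r ^ 2) - √(x ^ 2 - r ^ 2)) ^ (d - 1) * (x / √(x ^ 2 - r ^ 2)) *
    (y / √(y ^ 2 - r ^ 2))

theorem ofReal_chord_pow_eq_lintegral {d : ℕ} (hd : 1 ≤ d) {a b r : ℝ} (ha : 0 ≤ a) (hab : a ≤ b)
    (hr : 0 < r) :
    ENNReal.ofReal ((√(b ^ 2 - r ^ 2) - √(a ^ 2 - r ^ 2)) ^ (d + 1)) =
      ENNReal.ofReal (d * (d + 1)) * ∫⁻ y in Ioo (max a r) b, ∫⁻ x in Ioo (max a r) y,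
        ENNReal.ofReal (chordKernel d x y r) := by
  have hd0 : (0 : ℝ) < d := by exact_mod_cast hd
  rcases le_or_gt b (max a r) with hb | hb
  · have : b ≤ r ∨ b = a := by
      rcases le_max_iff.1 hb with h | h
      · exact .inr (le_antisymm h hab)
      · exact .inl h
    have h0 : √(b ^ 2 - r ^ 2) - √(a ^ 2 - r ^ 2) = 0 := by
      rcases this with h | h
      · rw [Real.sqrt_eq_zero_of_nonpos (by nlinarith), Real.sqrt_eq_zero_of_nonpos (by nlinarith),
          sub_zero]
      · rw [h, sub_self]
    rw [h0, Ioo_eq_empty (not_lt.2 hb)]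
    simp
  set c := max a r
  have hrc : r ≤ c := le_max_right _ _
  have hα : √(c ^ 2 - r ^ 2) = √(a ^ 2 - r ^ 2) := sqrt_max_sq_sub_sq ha
  have inner : ∀ y ∈ Ioo c b, ∫⁻ x in Ioo c y, ENNReal.ofReal (chordKernel d x y r) =
      ENNReal.ofReal ((√(y ^ 2 - r ^ 2) - √(c ^ 2 - r ^ 2)) ^ d / d * (y / √(y ^ 2 - r ^ 2))) := by
    intro y hy
    have hy0 : 0 ≤ y := by linarith [hy.1]
    have h := (integrableOn_and_lintegral_of_hasDerivAt_nonneg (a := c) (b := y)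
      (F := fun x => -((√(y ^ 2 - r ^ 2) - √(x ^ 2 - r ^ 2)) ^ d / d * (y / √(y ^ 2 - r ^ 2))))
      (f := fun x => chordKernel d x y r) hy.1.le (by fun_prop) ?_ ?_).2.2
    · rw [h]
      congr 1
      simp [show d ≠ 0 by omega]
    · intro x hx
      have h1 := ((((hasDerivAt_sqrt_sq_sub_sq hr.le (hrc.trans_lt hx.1)).const_sub
        (√(y ^ 2 - r ^ 2))).pow d).div_const (d : ℝ)).mul_const (y / √(y ^ 2 - r ^ 2))
      refine h1.neg.congr_deriv ?_
      unfold chordKernel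
      field_simp
    · intro x hx
      have hx0 : 0 ≤ x := by linarith [hx.1]
      have : √(x ^ 2 - r ^ 2) ≤ √(y ^ 2 - r ^ 2) := Real.sqrt_le_sqrt (by nlinarith [hx.2])
      have := sub_nonneg.2 this
      unfold chordKernel
      positivity
  rw [setLIntegral_congr_fun measurableSet_Ioo inner]
  rw [(integrableOn_and_lintegral_of_hasDerivAt_nonneg (a := c) (b := b)
      (F := fun y => (√(y ^ 2 - r ^ 2) - √(c ^ 2 - r ^ 2)) ^ (d + 1) / (d * (d + 1)))
      (f := fun y => (√(y ^ 2 - r ^ 2) - √(c ^ 2 - r ^ 2)) ^ d / d * (y / √(y ^ 2 - r ^ 2)))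
      hb.le (by fun_prop) ?_ ?_).2.2]
  · rw [← ENNReal.ofReal_mul (by positivity), hα]
    congr 1
    simp
    field_simp
  · intro y hy
    have h1 := (((hasDerivAt_sqrt_sq_sub_sq hr.le (hrc.trans_lt hy.1)).sub_const
      (√(c ^ 2 - r ^ 2))).pow (d + 1)).div_const ((d : ℝ) * (d + 1))
    refine h1.congr_deriv ?_
    push_cast
    field_simp
  · intro y hy
    have hy0 : 0 ≤ y := by linarith [hy.1]
    have : √(c ^ 2 - r ^ 2) ≤ √(y ^ 2 - r ^ 2) := Real.sqrt_le_sqrt (by nlinarith [hy.1])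
    have := sub_nonneg.2 this
    positivity

theorem lintegral_Ioo_mul_left {x : ℝ} (hx : 0 < x) (f : ℝ → ENNReal) :
    ∫⁻ r in Ioo 0 x, f r = ∫⁻ s in Ioo 0 1, ENNReal.ofReal x * f (x * s) := by
  have him : (fun s => x * s) '' Ioo 0 1 = Ioo 0 x := by
    simpa using image_mul_left_Ioo hx 0 1
  rw [← him, lintegral_image_eq_lintegral_abs_deriv_mul (f' := fun _ => x) measurableSet_Ioo
    (fun s _ => by simpa using ((hasDerivAt_id s).const_mul x).hasDerivWithinAt)
    (fun s _ t _ h => mul_left_cancel₀ hx.ne' h), abs_of_pos hx]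

theorem lintegral_Ioo_pow_mul {d : ℕ} (hd : 1 ≤ d) {a b : ℝ} (ha : 0 ≤ a) (hab : a ≤ b)
    (g : ℝ → ENNReal) :
    ∫⁻ x in Ioo a b, ENNReal.ofReal (x ^ (d - 1)) * g x =
      ENNReal.ofReal (1 / d) * ∫⁻ s in Ioo (a ^ d) (b ^ d), g (s ^ (1 / d : ℝ)) := by
  have hd0 : (0 : ℝ) < d := by exact_mod_cast hd
  have hdne : d ≠ 0 := by omega
  have him : (fun x : ℝ => x ^ d) '' Ioo a b = Ioo (a ^ d) (b ^ d) := by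
    ext s
    constructor
    · rintro ⟨x, hx, rfl⟩
      exact ⟨pow_lt_pow_left₀ hx.1 ha hdne, pow_lt_pow_left₀ hx.2 (ha.trans hx.1.le) hdne⟩
    · intro hs
      have hs0 : 0 ≤ s := (pow_nonneg ha d).trans hs.1.le
      have hsd : (s ^ (d : ℝ)⁻¹) ^ d = s := Real.rpow_inv_natCast_pow hs0 hdne
      refine ⟨s ^ (d : ℝ)⁻¹, ⟨?_, ?_⟩, hsd⟩
      · exact lt_of_pow_lt_pow_left₀ d (by positivity) (hsd.symm ▸ hs.1)
      · exact lt_of_pow_lt_pow_left₀ d (ha.trans hab) (hsd.symm ▸ hs.2)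
  rw [← him, lintegral_image_eq_lintegral_abs_deriv_mul (f' := fun x => d * x ^ (d - 1))
    measurableSet_Ioo (fun x _ => (hasDerivAt_pow d x).hasDerivWithinAt)
    (fun x hx y hy h => (pow_left_inj₀ (ha.trans hx.1.le) (ha.trans hy.1.le) hdne).1 h),
    ← lintegral_const_mul' _ _ ENNReal.ofReal_ne_top]
  refine setLIntegral_congr_fun measurableSet_Ioo fun x hx => ?_
  have hx0 : 0 ≤ x := ha.trans hx.1.le
  simp only [one_div]
  rw [Real.pow_rpow_inv_natCast hx0 hdne, abs_of_nonneg (by positivity), ← mul_assoc,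
    ← ENNReal.ofReal_mul (by positivity)]
  congr 2
  field_simp

theorem lintegral_Ioo_sub_right (a b c : ℝ) (f : ℝ → ENNReal) :
    ∫⁻ x in Ioo a b, f x = ∫⁻ x in Ioo (a - c) (b - c), f (x + c) := by
  have := (measurePreserving_add_right volume c).setLIntegral_comp_preimage_emb
    (measurableEmbedding_addRight c) f (Ioo a b)
  simpa using this.symm

/-- The profile of the averaged chord kernel as a function of the ratio of the two radii. -/
def chordProfile (d : ℕ) (t s : ℝ) : ℝ :=
  (√(1 - t ^ 2 * s ^ 2) - t * √(1 - s ^ 2)) ^ (d - 1) * s ^ (d - 2) /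
    (√(1 - s ^ 2) * √(1 - t ^ 2 * s ^ 2))

theorem chordProfile_le {d : ℕ} (hd : 2 ≤ d) {t₁ t₂ s : ℝ} (h1 : 0 ≤ t₁) (h12 : t₁ ≤ t₂)
    (h2 : t₂ ≤ 1) (hs : s ∈ Ioo (0 : ℝ) 1) : chordProfile d t₂ s ≤ chordProfile d t₁ s := by
  have ht2 : 0 ≤ t₂ := h1.trans h12
  have hs2 : s ^ 2 < 1 := by nlinarith [hs.1, hs.2]
  have hsp : 0 < s ^ 2 := by have := hs.1; positivity
  have hsq : t₁ ^ 2 ≤ t₂ ^ 2 := by nlinarith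
  have hsq1 : t₂ ^ 2 ≤ 1 := by nlinarith
  have hM : 0 < √(1 - s ^ 2) := Real.sqrt_pos.2 (by linarith)
  have hP2 : 0 < √(1 - t₂ ^ 2 * s ^ 2) := Real.sqrt_pos.2 (by nlinarith)
  have hP12 : √(1 - t₂ ^ 2 * s ^ 2) ≤ √(1 - t₁ ^ 2 * s ^ 2) := Real.sqrt_le_sqrt (by nlinarith)
  have hM2 : √(1 - s ^ 2) ≤ √(1 - t₂ ^ 2 * s ^ 2) := Real.sqrt_le_sqrt (by nlinarith)
  have key : ∀ t, chordProfile d t s = (√(1 - t ^ 2 * s ^ 2) - t * √(1 - s ^ 2)) ^ (d - 2) *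
      ((√(1 - t ^ 2 * s ^ 2) - t * √(1 - s ^ 2)) / √(1 - t ^ 2 * s ^ 2)) *
      (s ^ (d - 2) / √(1 - s ^ 2)) := by
    intro t
    unfold chordProfile
    rw [show d - 1 = d - 2 + 1 by omega, pow_succ]
    ring
  rw [key, key]
  generalize √(1 - s ^ 2) = M at *
  generalize √(1 - t₂ ^ 2 * s ^ 2) = P2 at *
  generalize √(1 - t₁ ^ 2 * s ^ 2) = P1 at *
  have hB2 : 0 ≤ P2 - t₂ * M := by nlinarith
  have hB : P2 - t₂ * M ≤ P1 - t₁ * M := by nlinarith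
  have hq : (P2 - t₂ * M) / P2 ≤ (P1 - t₁ * M) / P1 := by
    rw [div_le_div_iff₀ hP2 (by linarith)]
    nlinarith [mul_le_mul h12 hP12 hP2.le ht2]
  have hs0 := hs.1
  have := hB2.trans hB
  gcongr

theorem lintegral_chordKernel {d : ℕ} (hd : 2 ≤ d) {x y : ℝ} (hx : 0 < x) (hy : 0 < y) :
    ∫⁻ r in Ioo 0 x, ENNReal.ofReal (chordKernel d x y r) * ENNReal.ofReal (r ^ (d - 2)) =
      ENNReal.ofReal (y ^ (d - 1)) * (ENNReal.ofReal (x ^ (d - 1)) *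
        ∫⁻ s in Ioo 0 1, ENNReal.ofReal (chordProfile d (x / y) s)) := by
  rw [lintegral_Ioo_mul_left hx, ← lintegral_const_mul' _ _ ENNReal.ofReal_ne_top,
    ← lintegral_const_mul' _ _ ENNReal.ofReal_ne_top]
  refine setLIntegral_congr_fun measurableSet_Ioo fun s hs => ?_
  have hs0 := hs.1
  rw [← ENNReal.ofReal_mul' (by positivity), ← ENNReal.ofReal_mul (by positivity),
    ← ENNReal.ofReal_mul (by positivity), ← ENNReal.ofReal_mul (by positivity)]
  congr 1
  have e1 : √(x ^ 2 - (x * s) ^ 2) = x * √(1 - s ^ 2) := by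
    rw [show x ^ 2 - (x * s) ^ 2 = x ^ 2 * (1 - s ^ 2) by ring, Real.sqrt_mul (by positivity),
      Real.sqrt_sq hx.le]
  have e2 : √(y ^ 2 - (x * s) ^ 2) = y * √(1 - (x / y) ^ 2 * s ^ 2) := by
    rw [show y ^ 2 - (x * s) ^ 2 = y ^ 2 * (1 - (x / y) ^ 2 * s ^ 2) by field_simp,
      Real.sqrt_mul (by positivity), Real.sqrt_sq hy.le]
  unfold chordKernel chordProfile
  rw [e1, e2]
  obtain ⟨n, rfl⟩ : ∃ n, d = n + 2 := ⟨d - 2, by omega⟩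
  generalize √(1 - (x / y) ^ 2 * s ^ 2) = P
  generalize √(1 - s ^ 2) = M
  have e3 : y * P - x * M = y * (P - x / y * M) := by field_simp
  rw [e3, mul_pow, mul_pow, div_mul_eq_div_div x x M, div_mul_eq_div_div y y P, div_self hx.ne',
    div_self hy.ne']
  simp only [Nat.add_sub_cancel, show n + 2 - 1 = n + 1 by omega]
  ring

theorem lintegral_eq_setLIntegral {s : Set ℝ} (hs : MeasurableSet s) {f g : ℝ → ENNReal}
    (h0 : ∀ x ∉ s, g x = 0) (h : ∀ x ∈ s, g x = f x) : ∫⁻ x, g x = ∫⁻ x in s, f x := by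
  rw [← lintegral_indicator hs]
  congr 1
  ext x
  by_cases hx : x ∈ s
  · rw [indicator_of_mem hx, h x hx]
  · rw [indicator_of_notMem hx, h0 x hx]

theorem lintegral_triangle_swap {a b : ℝ} {f : ℝ × ℝ × ℝ → ENNReal}
    (hf : Measurable f) :
    ∫⁻ r in Ioi 0, ∫⁻ y in Ioo (max a r) b, ∫⁻ x in Ioo (max a r) y, f (r, y, x) =
      ∫⁻ y in Ioo a b, ∫⁻ x in Ioo a y, ∫⁻ r in Ioo 0 x, f (r, y, x) := by
  set S : Set (ℝ × ℝ × ℝ) :=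
    {p | 0 < p.1 ∧ a < p.2.2 ∧ p.1 < p.2.2 ∧ p.2.2 < p.2.1 ∧ p.2.1 < b}
  have hSm : MeasurableSet S := by
    have h1 : Measurable fun p : ℝ × ℝ × ℝ => p.2.1 := by fun_prop
    have h2 : Measurable fun p : ℝ × ℝ × ℝ => p.2.2 := by fun_prop
    exact (measurableSet_lt measurable_const measurable_fst).inter <|
      (measurableSet_lt measurable_const h2).inter <| (measurableSet_lt measurable_fst h2).inter <|
      (measurableSet_lt h2 h1).inter (measurableSet_lt h1 measurable_const)
  have hg : Measurable (S.indicator f) := hf.indicator hSm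
  have zero : ∀ p, p ∉ S → S.indicator f p = 0 := fun p hp => indicator_of_notMem hp f
  have one : ∀ p, p ∈ S → S.indicator f p = f p := fun p hp => indicator_of_mem hp f
  have left : ∫⁻ r, ∫⁻ y, ∫⁻ x, S.indicator f (r, y, x) =
      ∫⁻ r in Ioi 0, ∫⁻ y in Ioo (max a r) b, ∫⁻ x in Ioo (max a r) y, f (r, y, x) := by
    refine lintegral_eq_setLIntegral measurableSet_Ioi (fun r hr => ?_) fun r hr => ?_
    · simp [zero (r, _, _) fun h => hr h.1]
    refine lintegral_eq_setLIntegral measurableSet_Ioo (fun y hy => ?_) fun y hy => ?_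
    · simp [zero (r, y, _) fun h =>
        hy ⟨max_lt (h.2.1.trans h.2.2.2.1) (h.2.2.1.trans h.2.2.2.1), h.2.2.2.2⟩]
    refine lintegral_eq_setLIntegral measurableSet_Ioo (fun x hx => ?_) fun x hx => ?_
    · exact zero _ fun h => hx ⟨max_lt h.2.1 h.2.2.1, h.2.2.2.1⟩
    · exact one _ ⟨hr, (max_lt_iff.1 hx.1).1, (max_lt_iff.1 hx.1).2, hx.2, hy.2⟩
  have right : ∫⁻ y, ∫⁻ x, ∫⁻ r, S.indicator f (r, y, x) =
      ∫⁻ y in Ioo a b, ∫⁻ x in Ioo a y, ∫⁻ r in Ioo 0 x, f (r, y, x) := by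
    refine lintegral_eq_setLIntegral measurableSet_Ioo (fun y hy => ?_) fun y hy => ?_
    · simp [zero (_, y, _) fun h => hy ⟨h.2.1.trans h.2.2.2.1, h.2.2.2.2⟩]
    refine lintegral_eq_setLIntegral measurableSet_Ioo (fun x hx => ?_) fun x hx => ?_
    · simp [zero (_, y, x) fun h => hx ⟨h.2.1, h.2.2.2.1⟩]
    refine lintegral_eq_setLIntegral measurableSet_Ioo (fun r hr => ?_) fun r hr => ?_
    · exact zero _ fun h => hr ⟨h.1, h.2.2.1⟩
    · exact one _ ⟨hr.1, hx.1, hr.2, hx.2, hy.2⟩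
  rw [← left, ← right, lintegral_lintegral_swap]
  · refine lintegral_congr fun y => lintegral_lintegral_swap ?_
    exact (hg.comp (by fun_prop : Measurable fun p : ℝ × ℝ => (p.1, y, p.2))).aemeasurable
  · have : Measurable fun p : (ℝ × ℝ) × ℝ => S.indicator f (p.1.1, p.1.2, p.2) :=
      hg.comp (by fun_prop)
    exact this.lintegral_prod_right'.aemeasurable

theorem lintegral_chord_pow {d : ℕ} (hd : 2 ≤ d) {a b : ℝ} (ha : 0 ≤ a) (hab : a ≤ b) :
    ∫⁻ r in Ioi 0, ENNReal.ofReal (r ^ (d - 2)) *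
        ENNReal.ofReal ((√(b ^ 2 - r ^ 2) - √(a ^ 2 - r ^ 2)) ^ (d + 1)) =
      ENNReal.ofReal (d * (d + 1)) * (ENNReal.ofReal (1 / d) * (ENNReal.ofReal (1 / d) *
        ∫⁻ η in Ioo (a ^ d) (b ^ d), ∫⁻ ξ in Ioo (a ^ d) η, ∫⁻ s in Ioo 0 1,
          ENNReal.ofReal (chordProfile d ((ξ / η) ^ (1 / d : ℝ)) s))) := by
  have hdne : d ≠ 0 := by omega
  have e1 : ∀ r ∈ Ioi (0 : ℝ), ENNReal.ofReal (r ^ (d - 2)) *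
        ENNReal.ofReal ((√(b ^ 2 - r ^ 2) - √(a ^ 2 - r ^ 2)) ^ (d + 1)) =
      ENNReal.ofReal (d * (d + 1)) * ∫⁻ y in Ioo (max a r) b, ∫⁻ x in Ioo (max a r) y,
        ENNReal.ofReal (chordKernel d x y r) * ENNReal.ofReal (r ^ (d - 2)) := by
    intro r hr
    rw [ofReal_chord_pow_eq_lintegral (by omega) ha hab hr]
    simp_rw [lintegral_mul_const' _ _ ENNReal.ofReal_ne_top]
    ring
  rw [setLIntegral_congr_fun measurableSet_Ioi e1, lintegral_const_mul' _ _ ENNReal.ofReal_ne_top,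
    lintegral_triangle_swap (f := fun p => ENNReal.ofReal (chordKernel d p.2.2 p.2.1 p.1) *
      ENNReal.ofReal (p.1 ^ (d - 2))) (by unfold chordKernel; fun_prop)]
  congr 1
  have e2 : ∀ y ∈ Ioo a b, ∫⁻ x in Ioo a y, ∫⁻ r in Ioo 0 x,
        ENNReal.ofReal (chordKernel d x y r) * ENNReal.ofReal (r ^ (d - 2)) =
      ENNReal.ofReal (y ^ (d - 1)) * (ENNReal.ofReal (1 / d) * ∫⁻ ξ in Ioo (a ^ d) (y ^ d),
        ∫⁻ s in Ioo 0 1, ENNReal.ofReal (chordProfile d (ξ ^ (1 / d : ℝ) / y) s)) := by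
    intro y hy
    rw [← lintegral_Ioo_pow_mul (by omega) ha hy.1.le
      (fun x => ∫⁻ s in Ioo 0 1, ENNReal.ofReal (chordProfile d (x / y) s)),
      ← lintegral_const_mul' _ _ ENNReal.ofReal_ne_top]
    exact setLIntegral_congr_fun measurableSet_Ioo fun x hx =>
      lintegral_chordKernel hd (ha.trans_lt hx.1) (ha.trans_lt hy.1)
  rw [setLIntegral_congr_fun measurableSet_Ioo e2, lintegral_Ioo_pow_mul (by omega) ha hab
    (fun y => ENNReal.ofReal (1 / d) * ∫⁻ ξ in Ioo (a ^ d) (y ^ d),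
        ∫⁻ s in Ioo 0 1, ENNReal.ofReal (chordProfile d (ξ ^ (1 / d : ℝ) / y) s)),
    lintegral_const_mul' _ _ ENNReal.ofReal_ne_top]
  congr 2
  refine setLIntegral_congr_fun measurableSet_Ioo fun η hη => ?_
  have ha' : 0 ≤ a ^ d := by positivity
  have hη0 : 0 ≤ η := ha'.trans hη.1.le
  have : (η ^ (1 / d : ℝ)) ^ d = η := by
    rw [one_div]; exact Real.rpow_inv_natCast_pow hη0 hdne
  simp only [this]
  refine setLIntegral_congr_fun measurableSet_Ioo fun ξ hξ => ?_
  rw [Real.div_rpow (ha'.trans hξ.1.le) hη0]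

theorem lintegral_chord_pow_le {d : ℕ} (hd : 2 ≤ d) {a b a' b' : ℝ} (ha' : 0 ≤ a') (haa : a' ≤ a)
    (hab : a ≤ b) (hab' : a' ≤ b') (h : b' ^ d - a' ^ d = b ^ d - a ^ d) :
    ∫⁻ r in Ioi 0, ENNReal.ofReal (r ^ (d - 2)) *
        ENNReal.ofReal ((√(b ^ 2 - r ^ 2) - √(a ^ 2 - r ^ 2)) ^ (d + 1)) ≤
      ∫⁻ r in Ioi 0, ENNReal.ofReal (r ^ (d - 2)) *
        ENNReal.ofReal ((√(b' ^ 2 - r ^ 2) - √(a' ^ 2 - r ^ 2)) ^ (d + 1)) := by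
  have hp : a' ^ d ≤ a ^ d := pow_le_pow_left₀ ha' haa d
  have h0 : 0 ≤ a' ^ d := by positivity
  rw [lintegral_chord_pow hd (ha'.trans haa) hab, lintegral_chord_pow hd ha' hab']
  refine mul_le_mul_right (mul_le_mul_right (mul_le_mul_right ?_ _) _) _
  set c := a ^ d - a' ^ d with hc
  rw [lintegral_Ioo_sub_right _ _ c, show a ^ d - c = a' ^ d by rw [hc]; ring,
    show b ^ d - c = b' ^ d by rw [hc]; linarith]
  refine setLIntegral_mono' measurableSet_Ioo fun η hη => ?_
  rw [lintegral_Ioo_sub_right _ _ c, show a ^ d - c = a' ^ d by rw [hc]; ring,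
    add_sub_cancel_right]
  refine setLIntegral_mono' measurableSet_Ioo fun ξ hξ => ?_
  refine setLIntegral_mono' measurableSet_Ioo fun s hs => ENNReal.ofReal_le_ofReal ?_
  have hξ0 : 0 < ξ := h0.trans_lt hξ.1
  have hη0 : 0 < η := hξ0.trans hξ.2
  have hc0 : 0 ≤ c := sub_nonneg.2 hp
  refine chordProfile_le hd (by positivity) ?_ ?_ hs
  · refine Real.rpow_le_rpow (by positivity) ?_ (by positivity)
    rw [div_le_div_iff₀ hη0 (by positivity)]
    nlinarith [hξ.2]
  · refine Real.rpow_le_one (by positivity) ?_ (by positivity)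
    rw [div_le_one (by positivity)]
    linarith [hξ.2]

theorem chord_le_of_pow_sub_eq {d : ℕ} (hd : 2 ≤ d) {a b a' b' r : ℝ} (ha' : 0 ≤ a')
    (haa : a' < a) (hab : a < b) (hab' : a' ≤ b') (h : b' ^ d - a' ^ d = b ^ d - a ^ d)
    (hr : 0 ≤ r) (hra : r ≤ a') :
    √(b ^ 2 - r ^ 2) - √(a ^ 2 - r ^ 2) ≤ √(b' ^ 2 - r ^ 2) - √(a' ^ 2 - r ^ 2) := by
  have hdne : d ≠ 0 := by omega
  have hd2 : (2 : ℝ) ≤ d := by exact_mod_cast hd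
  have hrd : 0 ≤ r ^ d := by positivity
  have root : ∀ x : ℝ, 0 ≤ x → (x ^ d) ^ (2 / d : ℝ) = x ^ 2 := by
    intro x hx
    rw [← Real.rpow_natCast x d, ← Real.rpow_mul hx, mul_div_cancel₀ _ (by positivity)]
    norm_cast
  have hconc : ConcaveOn ℝ (Ici (r ^ d)) fun s : ℝ => √(s ^ (2 / d : ℝ) - r ^ 2) := by
    have h1 : ConcaveOn ℝ (Ici (r ^ d)) fun s : ℝ => s ^ (2 / d : ℝ) + -r ^ 2 := by
      have h2 : ConcaveOn ℝ (Ici 0) fun s : ℝ => s ^ (2 / d : ℝ) :=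
        Real.concaveOn_rpow (by positivity) ((div_le_one (by positivity)).2 hd2)
      exact ConcaveOn.add_const (h2.subset (Ici_subset_Ici.2 hrd) (convex_Ici _)) _
    simp only [← sub_eq_add_neg] at h1
    refine ⟨convex_Ici _, fun x hx y hy u v hu hv huv => ?_⟩
    have nonneg : ∀ z ∈ Ici (r ^ d), 0 ≤ z ^ (2 / d : ℝ) - r ^ 2 := by
      intro z hz
      rw [sub_nonneg, ← root r hr]
      exact Real.rpow_le_rpow hrd hz (by positivity)
    exact (Real.strictConcaveOn_sqrt.concaveOn.2 (nonneg x hx) (nonneg y hy) hu hv huv).trans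
      (Real.sqrt_le_sqrt (h1.2 hx hy hu hv huv))
  have hA : a' ^ d < a ^ d := pow_lt_pow_left₀ haa ha' hdne
  have hB : a ^ d < b ^ d := pow_lt_pow_left₀ hab (by linarith) hdne
  have hR : r ^ d ≤ a' ^ d := pow_le_pow_left₀ hr hra d
  have hpos : 0 < b ^ d - a' ^ d := by linarith
  set l := (a ^ d - a' ^ d) / (b ^ d - a' ^ d)
  have hl0 : 0 ≤ l := div_nonneg (by linarith) hpos.le
  have hl1 : l ≤ 1 := (div_le_one hpos).2 (by linarith)
  have hm : l * (b ^ d - a' ^ d) = a ^ d - a' ^ d := div_mul_cancel₀ _ hpos.ne'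
  have hmemA : a' ^ d ∈ Ici (r ^ d) := hR
  have hmemB : b ^ d ∈ Ici (r ^ d) := hR.trans (hA.trans hB).le
  have c1 := hconc.2 hmemA hmemB (sub_nonneg.2 hl1) hl0 (sub_add_cancel 1 l)
  have c2 := hconc.2 hmemA hmemB hl0 (sub_nonneg.2 hl1) (add_sub_cancel l 1)
  simp only [smul_eq_mul] at c1 c2
  rw [show (1 - l) * a' ^ d + l * b ^ d = a ^ d by linarith, root _ ha', root _ (by linarith),
    root _ (by linarith)] at c1
  rw [show l * a' ^ d + (1 - l) * b ^ d = b' ^ d by linarith, root _ ha', root _ (by linarith),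
    root _ (by linarith)] at c2
  linarith

theorem T_one_indicator {F : Set ℝ} (hF : MeasurableSet F) (r : ℝ) (hr : 0 ≤ r) :
    T 1 (F.indicator fun _ => (1 : ℝ)) r = ∫ u in Ioi r ∩ F, u / √(u ^ 2 - r ^ 2) := by
  rw [← setIntegral_indicator hF]
  refine setIntegral_congr_fun measurableSet_Ioi fun u hu => ?_
  have hu : r < u := hu
  have h0 : 0 ≤ u ^ 2 - r ^ 2 := by nlinarith
  by_cases huF : u ∈ F
  · simp only [indicator_of_mem huF]
    rw [show ((1 : ℕ) : ℝ) / 2 - 1 = -(1 / 2) by norm_num, Real.rpow_neg h0,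
      ← Real.sqrt_eq_rpow]
    ring
  · simp [indicator_of_notMem huF]

theorem integrableOn_Ioo_and_integral_div_sqrt {a b r : ℝ} (hr : 0 ≤ r) (ha : r ≤ a) (hab : a ≤ b) :
    IntegrableOn (fun u => u / √(u ^ 2 - r ^ 2)) (Ioo a b) ∧
      ∫ u in Ioo a b, u / √(u ^ 2 - r ^ 2) = √(b ^ 2 - r ^ 2) - √(a ^ 2 - r ^ 2) := by
  have h := integrableOn_and_lintegral_of_hasDerivAt_nonneg
    (F := fun u => √(u ^ 2 - r ^ 2)) hab (by fun_prop)
    (fun u hu => hasDerivAt_sqrt_sq_sub_sq hr (ha.trans_lt hu.1))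
    (fun u hu => div_nonneg ((hr.trans ha).trans hu.1.le) (Real.sqrt_nonneg _))
  exact ⟨h.1, h.2.1⟩

theorem T_one_indicator_Ioo {a b r : ℝ} (hr : 0 < r) (hab : a ≤ b) (hb : 0 ≤ b) :
    T 1 ((Ioo a b).indicator fun _ => (1 : ℝ)) r =
      √(b ^ 2 - r ^ 2) - √(max a 0 ^ 2 - r ^ 2) := by
  have hset : Ioi r ∩ Ioo a b = Ioo (max (max a 0) r) b := by
    ext u
    simp only [mem_inter_iff, mem_Ioi, mem_Ioo, max_lt_iff]
    constructor
    · rintro ⟨h1, h2, h3⟩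
      exact ⟨⟨⟨h2, hr.trans h1⟩, h1⟩, h3⟩
    · rintro ⟨⟨⟨h1, -⟩, h2⟩, h3⟩
      exact ⟨h2, h1, h3⟩
  rw [T_one_indicator measurableSet_Ioo r hr.le, hset,
    ← sqrt_max_sq_sub_sq (r := r) (le_max_right a 0)]
  rcases le_total (max (max a 0) r) b with h | h
  · exact (integrableOn_Ioo_and_integral_div_sqrt hr.le (le_max_right _ _) h).2
  · rcases le_max_iff.1 h with h' | h'
    · have hbe : b = max a 0 := le_antisymm h' (max_le hab hb)
      rw [← hbe, sqrt_max_sq_sub_sq hb]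
      simp
    · have : max (max a 0) r = r := max_eq_right ((max_le hab hb).trans h')
      rw [this, Real.sqrt_eq_zero_of_nonpos (by nlinarith : b ^ 2 - r ^ 2 ≤ 0)]
      simp [h']

theorem T_one_indicator_union {F G : Set ℝ} (hF : MeasurableSet F) (hG : MeasurableSet G)
    (hFG : Disjoint F G) {M : ℝ} (hFM : ∀ x ∈ F, x < M) (hGM : ∀ x ∈ G, x < M) {r : ℝ}
    (hr : 0 ≤ r) :
    T 1 ((F ∪ G).indicator fun _ => (1 : ℝ)) r =
      T 1 (F.indicator fun _ => (1 : ℝ)) r + T 1 (G.indicator fun _ => (1 : ℝ)) r := by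
  have hint : ∀ H : Set ℝ, (∀ x ∈ H, x < M) →
      IntegrableOn (fun u => u / √(u ^ 2 - r ^ 2)) (Ioi r ∩ H) := by
    intro H hH
    refine (integrableOn_Ioo_and_integral_div_sqrt hr le_rfl (le_max_left r M)).1.mono_set ?_
    exact fun u hu => ⟨hu.1, (hH u hu.2).trans_le (le_max_right _ _)⟩
  rw [T_one_indicator (hF.union hG) r hr, T_one_indicator hF r hr, T_one_indicator hG r hr,
    inter_union_distrib_left]
  exact setIntegral_union (hFG.mono inter_subset_right inter_subset_right)
    (measurableSet_Ioi.inter hG) (hint F hFM) (hint G hGM)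

theorem T_one_indicator_nonneg {F : Set ℝ} (hF : MeasurableSet F) {r : ℝ} (hr : 0 ≤ r) :
    0 ≤ T 1 (F.indicator fun _ => (1 : ℝ)) r := by
  rw [T_one_indicator hF r hr]
  refine setIntegral_nonneg (measurableSet_Ioi.inter hF) fun u hu => ?_
  exact div_nonneg (hr.trans (le_of_lt hu.1)) (Real.sqrt_nonneg _)

theorem T_one_indicator_eq_zero {F : Set ℝ} (hF : MeasurableSet F) {r : ℝ} (hr : 0 ≤ r)
    (hFr : ∀ x ∈ F, x ≤ r) : T 1 (F.indicator fun _ => (1 : ℝ)) r = 0 := by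
  have : Ioi r ∩ F = ∅ := by
    ext u
    simp only [mem_inter_iff, mem_Ioi, mem_empty_iff_false, iff_false, not_and]
    exact fun h hu => (hFr u hu).not_gt h
  rw [T_one_indicator hF r hr, this]
  simp

theorem mu_Ioo {d : ℕ} (hd : 1 ≤ d) {a b : ℝ} (hab : max a 0 ≤ b) :
    mu d (Ioo a b) = ENNReal.ofReal (b ^ d / d - max a 0 ^ d / d) := by
  have hd0 : (0 : ℝ) < d := by exact_mod_cast hd
  have hset : Ioo a b ∩ Ioi 0 = Ioo (max a 0) b := by
    ext u
    simp only [mem_inter_iff, mem_Ioi, mem_Ioo, max_lt_iff]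
    tauto
  rw [mu, withDensity_apply _ measurableSet_Ioo, Measure.restrict_restrict measurableSet_Ioo, hset]
  refine (integrableOn_and_lintegral_of_hasDerivAt_nonneg (F := fun u => u ^ d / d)
    (f := fun u => u ^ (d - 1)) hab (by fun_prop) ?_ ?_).2.2
  · intro u hu
    refine ((hasDerivAt_pow d u).div_const (d : ℝ)).congr_deriv ?_
    field_simp
  · intro u hu
    have := (le_max_right a 0).trans hu.1.le
    positivity

theorem pow_sub_eq_of_mu_eq {d : ℕ} (hd : 1 ≤ d) {a b a' b' : ℝ} (ha : 0 ≤ a) (hab : a < b)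
    (hab' : a' < b') (h : mu d (Ioo a' b') = mu d (Ioo a b)) :
    0 < b' ∧ b' ^ d - max a' 0 ^ d = b ^ d - a ^ d := by
  have hd0 : (0 : ℝ) < d := by exact_mod_cast hd
  have hpos : 0 < b ^ d / d - a ^ d / d := by
    rw [← sub_div]
    exact div_pos (sub_pos.2 (pow_lt_pow_left₀ hab ha (by omega))) hd0
  have hI := mu_Ioo hd (a := a) (b := b) (by rw [max_eq_left ha]; exact hab.le)
  rw [max_eq_left ha] at hI
  have hb' : 0 < b' := by
    by_contra! hb
    have h0 : mu d (Ioo a' b') = 0 := by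
      have : Ioo a' b' ∩ Ioi 0 = ∅ := by
        ext u
        simp only [mem_inter_iff, mem_Ioi, mem_Ioo, mem_empty_iff_false, iff_false]
        rintro ⟨⟨_, h1⟩, h2⟩
        linarith
      rw [mu, withDensity_apply _ measurableSet_Ioo, Measure.restrict_restrict measurableSet_Ioo,
        this]
      simp
    rw [← h, h0] at hI
    exact hpos.not_ge (ENNReal.ofReal_eq_zero.1 hI.symm)
  have hm : max a' 0 ≤ b' := max_le hab'.le hb'.le
  refine ⟨hb', ?_⟩
  rw [hI, mu_Ioo hd hm, ENNReal.ofReal_eq_ofReal_iff _ hpos.le] at h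
  · field_simp at h
    exact h
  · rw [← sub_div]
    exact div_nonneg (sub_nonneg.2 (pow_le_pow_left₀ (le_max_right _ _) hm d)) hd0.le

theorem add_pow_add_pow_le {s x y : ℝ} (hs : 0 ≤ s) (hx : 0 ≤ x) (hxy : x ≤ y) (n : ℕ) :
    (s + x) ^ n + y ^ n ≤ (s + y) ^ n + x ^ n := by
  induction n with
  | zero => simp
  | succ n ih =>
    have h1 : x ^ n ≤ y ^ n := pow_le_pow_left₀ hx hxy n
    have h2 : y ^ n ≤ (s + y) ^ n := pow_le_pow_left₀ (hx.trans hxy) (by linarith) n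
    simp only [pow_succ]
    nlinarith [mul_le_mul_of_nonneg_left ih (add_nonneg hs hx), mul_nonneg hs (sub_nonneg.2 h1),
      mul_nonneg (sub_nonneg.2 hxy) (sub_nonneg.2 h2)]

theorem eLpNorm_nu_one_le_of_lintegral_le {d : ℕ} {f g : ℝ → ℝ} (hf : ∀ r, 0 < r → 0 ≤ f r)
    (hg : ∀ r, 0 < r → 0 ≤ g r)
    (h : ∫⁻ r in Ioi 0, ENNReal.ofReal (r ^ (d - 2)) * ENNReal.ofReal (f r ^ (d + 1)) ≤
      ∫⁻ r in Ioi 0, ENNReal.ofReal (r ^ (d - 2)) * ENNReal.ofReal (g r ^ (d + 1))) :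
    eLpNorm f (ENNReal.ofReal (qExp d)) (nu d 1) ≤
      eLpNorm g (ENNReal.ofReal (qExp d)) (nu d 1) := by
  have hq : 0 < qExp d := by unfold qExp; positivity
  have key : ∀ F : ℝ → ℝ, (∀ r, 0 < r → 0 ≤ F r) →
      ∫⁻ r, ‖F r‖ₑ ^ (qExp d) ∂(nu d 1) =
        ∫⁻ r in Ioi 0, ENNReal.ofReal (r ^ (d - 2)) * ENNReal.ofReal (F r ^ (d + 1)) := by
    intro F hF
    rw [nu, lintegral_withDensity_eq_lintegral_mul_non_measurable _ (by fun_prop)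
      (.of_forall fun _ => ENNReal.ofReal_lt_top)]
    refine setLIntegral_congr_fun measurableSet_Ioi fun r hr => ?_
    have hFr := hF r hr
    simp only [Pi.mul_apply, Nat.sub_sub, Nat.reduceAdd]
    rw [Real.enorm_eq_ofReal hFr, qExp, ENNReal.ofReal_rpow_of_nonneg hFr (by positivity)]
    norm_cast
  rw [eLpNorm_eq_lintegral_rpow_enorm_toReal (by simpa using hq) ENNReal.ofReal_ne_top,
    eLpNorm_eq_lintegral_rpow_enorm_toReal (by simpa using hq) ENNReal.ofReal_ne_top,
    ENNReal.toReal_ofReal hq.le, key f hf, key g hg]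
  exact ENNReal.rpow_le_rpow h (by positivity)

theorem lintegral_chord_pow_ne_top (d : ℕ) {a b : ℝ} (hab : a ≤ b) (ha : 0 ≤ a) :
    ∫⁻ r in Ioi 0, ENNReal.ofReal (r ^ (d - 2)) *
        ENNReal.ofReal ((√(b ^ 2 - r ^ 2) - √(a ^ 2 - r ^ 2)) ^ (d + 1)) ≠ ⊤ := by
  have hb : 0 ≤ b := ha.trans hab
  have hle : ∫⁻ r in Ioi 0, ENNReal.ofReal (r ^ (d - 2)) *
        ENNReal.ofReal ((√(b ^ 2 - r ^ 2) - √(a ^ 2 - r ^ 2)) ^ (d + 1)) ≤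
      ∫⁻ r, (Ioc 0 b).indicator
        (fun _ => ENNReal.ofReal (b ^ (d - 2)) * ENNReal.ofReal (b ^ (d + 1))) r := by
    rw [← lintegral_indicator measurableSet_Ioi]
    refine lintegral_mono fun r => ?_
    by_cases hr : r ∈ Ioi (0 : ℝ)
    swap
    · simp [indicator_of_notMem hr]
    have hr0 : 0 < r := hr
    rw [indicator_of_mem hr]
    rcases le_or_gt r b with hrb | hrb
    · rw [indicator_of_mem (show r ∈ Ioc 0 b from ⟨hr, hrb⟩)]
      have h1 : √(b ^ 2 - r ^ 2) ≤ b := Real.sqrt_le_iff.2 ⟨hb, by nlinarith⟩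
      have h2 : 0 ≤ √(b ^ 2 - r ^ 2) - √(a ^ 2 - r ^ 2) :=
        sub_nonneg.2 (Real.sqrt_le_sqrt (by nlinarith))
      have h3 := Real.sqrt_nonneg (a ^ 2 - r ^ 2)
      gcongr
      linarith
    · rw [Real.sqrt_eq_zero_of_nonpos (by nlinarith), Real.sqrt_eq_zero_of_nonpos (by nlinarith)]
      simp
  refine (hle.trans_lt ?_).ne
  rw [lintegral_indicator measurableSet_Ioc, setLIntegral_const, Real.volume_Ioc]
  exact ENNReal.mul_lt_top (ENNReal.mul_lt_top ENNReal.ofReal_lt_top ENNReal.ofReal_lt_top)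
    ENNReal.ofReal_lt_top

/-- sliding the far interval toward the origin does not decrease
the `L^q(ν)`-norm of the image under `T` (case `k = 1`). -/
theorem T_indicator_slide_interval
    (d : ℕ) (hd : 3 ≤ d)
    (a b Δ Δ' : ℝ) (ha : 0 < a) (hab : a < b) (hΔ : 0 < Δ) (hΔ' : 0 ≤ Δ')
    (hI' : a - Δ < b - Δ')
    (E : Set ℝ) (hEmeas : MeasurableSet E) (hEsub : E ⊆ Ioc 0 a)
    (hEsup : ∀ x ∈ E, x ≤ a - Δ)
    (hmu : mu d (Ioo (a - Δ) (b - Δ')) = mu d (Ioo a b)) :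
    eLpNorm (T 1 ((E ∪ Ioo a b).indicator (fun _ => (1 : ℝ))))
        (ENNReal.ofReal (qExp d)) (nu d 1) ≤
      eLpNorm (T 1 ((E ∪ Ioo (a - Δ) (b - Δ')).indicator (fun _ => (1 : ℝ))))
        (ENNReal.ofReal (qExp d)) (nu d 1) := by
  obtain ⟨hb', hpow⟩ := pow_sub_eq_of_mu_eq (by omega) ha.le hab hI' hmu
  set b' := b - Δ'
  set a' := max (a - Δ) 0
  have ha' : 0 ≤ a' := le_max_right _ _
  have haa : a' < a := max_lt (by linarith) ha
  have hab' : a' ≤ b' := max_le hI'.le hb'.le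
  set S : ℝ → ℝ := T 1 (E.indicator fun _ => (1 : ℝ))
  set X : ℝ → ℝ := fun r => √(b ^ 2 - r ^ 2) - √(a ^ 2 - r ^ 2)
  set X' : ℝ → ℝ := fun r => √(b' ^ 2 - r ^ 2) - √(a' ^ 2 - r ^ 2)
  have hS0 : ∀ r, 0 < r → 0 ≤ S r := fun r hr => T_one_indicator_nonneg hEmeas hr.le
  have hX0 : ∀ r, 0 ≤ X r := fun r => sub_nonneg.2 (Real.sqrt_le_sqrt (by nlinarith))
  have hX'0 : ∀ r, 0 ≤ X' r := fun r => sub_nonneg.2 (Real.sqrt_le_sqrt (by nlinarith))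
  have hT : ∀ r, 0 < r → T 1 ((E ∪ Ioo a b).indicator fun _ => (1 : ℝ)) r = S r + X r := by
    intro r hr
    rw [T_one_indicator_union hEmeas measurableSet_Ioo _ (M := b)
      (fun x hx => (hEsub hx).2.trans_lt hab) (fun x hx => hx.2) hr.le,
      T_one_indicator_Ioo hr hab.le (ha.trans hab).le, max_eq_left ha.le]
    exact disjoint_left.2 fun x hx hx' => (hEsub hx).2.not_gt hx'.1
  have hT' : ∀ r, 0 < r →
      T 1 ((E ∪ Ioo (a - Δ) b').indicator fun _ => (1 : ℝ)) r = S r + X' r := by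
    intro r hr
    rw [T_one_indicator_union hEmeas measurableSet_Ioo _ (M := b')
      (fun x hx => (hEsup x hx).trans_lt hI') (fun x hx => hx.2) hr.le,
      T_one_indicator_Ioo hr hI'.le hb'.le]
    exact disjoint_left.2 fun x hx hx' => (hEsup x hx).not_gt hx'.1
  have hpt : ∀ r, 0 < r → (S r + X r) ^ (d + 1) + X' r ^ (d + 1) ≤
      (S r + X' r) ^ (d + 1) + X r ^ (d + 1) := by
    intro r hr
    rcases le_total r a' with h | h
    · exact add_pow_add_pow_le (hS0 r hr) (hX0 r)
        (chord_le_of_pow_sub_eq (by omega) ha' haa hab hab' hpow hr.le h) _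
    · have : S r = 0 := T_one_indicator_eq_zero hEmeas hr.le fun x hx =>
        (hEsup x hx).trans ((le_max_left _ _).trans h)
      rw [this, zero_add, zero_add, add_comm]
  refine eLpNorm_nu_one_le_of_lintegral_le
    (fun r hr => hT r hr ▸ add_nonneg (hS0 r hr) (hX0 r))
    (fun r hr => hT' r hr ▸ add_nonneg (hS0 r hr) (hX'0 r)) ?_
  have hfin := lintegral_chord_pow_ne_top d hab.le ha.le
  have hslide := lintegral_chord_pow_le (by omega : 2 ≤ d) ha' haa.le hab.le hab' hpow
  refine (ENNReal.add_le_add_iff_right hfin).1 ((add_le_add_right hslide _).trans ?_)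
  rw [← lintegral_add_right _ (by fun_prop), ← lintegral_add_right _ (by fun_prop)]
  refine setLIntegral_mono' measurableSet_Ioi fun r hr => ?_
  change _ * _ + _ * ENNReal.ofReal (X' r ^ _) ≤ _ * _ + _ * ENNReal.ofReal (X r ^ _)
  rw [hT r hr, hT' r hr, ← mul_add, ← mul_add,
    ← ENNReal.ofReal_add (pow_nonneg (add_nonneg (hS0 r hr) (hX0 r)) _) (pow_nonneg (hX'0 r) _),
    ← ENNReal.ofReal_add (pow_nonneg (add_nonneg (hS0 r hr) (hX'0 r)) _) (pow_nonneg (hX0 r) _)]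
  exact mul_le_mul_right (ENNReal.ofReal_le_ofReal (hpt r hr)) _
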